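/- arXiv:1811.08938 — 3 statements merged into one kernel-verified Lean document; each statement's English description precedes it below -/
import Mathlib

section
/- Let (R, 𝔪, k) be a commutative Noetherian local ring and let φ : (R, 𝔪, k) → (R', 𝔪', k') be a local homomorphism of commutative Noetherian local rings such that R' is flat as an R-module and the canonical map R' ⊗_R k → k' is an isomorphism. Then for every n ≥ 0 there is an isomorphism of R'-modules R' ⊗_R Ext_R^n(k, k) ≅ Ext_{R'}^n(k', k'). -/
universe u

open CategoryTheory Opposite TensorProduct IsLocalRing

/-- The canonical `R'`-algebra map `R' ⊗_R k → k'`, where `k` and `k'` are the residue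
fields of the local rings `R` and `R'` and `R → R'` is a local homomorphism. -/
noncomputable def residueFieldBaseChange (R R' : Type u) [CommRing R] [CommRing R']
    [IsLocalRing R] [IsLocalRing R'] [Algebra R R'] [IsLocalHom (algebraMap R R')] :
    R' ⊗[R] ResidueField R →ₐ[R'] ResidueField R' :=
  letI : IsScalarTower R R' (ResidueField R') :=
    IsScalarTower.of_algebraMap_eq fun _ => rfl
  Algebra.TensorProduct.lift (Algebra.ofId R' (ResidueField R'))
    ⟨ResidueField.map (algebraMap R R'), fun _ => rfl⟩
    (fun _ _ => Commute.all _ _)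

namespace ExtBC
open Limits


section Res
variable (R : Type u) [CommRing R]

lemma exists_cover (Z : ModuleCat.{u} R) : ∃ (F : ModuleCat.{u} R) (p : F ⟶ Z), Epi p ∧
    Module.Free R F ∧ (Module.Finite R Z → Module.Finite R F) := by
  by_cases h : Module.Finite R Z
  · obtain ⟨n, f, hf⟩ := Module.Finite.exists_fin' R Z
    exact ⟨ModuleCat.of R (Fin n → R), ModuleCat.ofHom f, (ModuleCat.epi_iff_surjective _).2 hf,
      inferInstanceAs (Module.Free R (Fin n → R)),
      fun _ => inferInstanceAs (Module.Finite R (Fin n → R))⟩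
  · exact ⟨ModuleCat.of R (Z →₀ R), ModuleCat.ofHom (Finsupp.linearCombination R id),
      (ModuleCat.epi_iff_surjective _).2 (Finsupp.linearCombination_id_surjective R Z),
      inferInstanceAs (Module.Free R (Z →₀ R)), fun h' => absurd h' h⟩

variable {R}

noncomputable def ov (Z : ModuleCat.{u} R) : ModuleCat.{u} R := (exists_cover R Z).choose
noncomputable def pr (Z : ModuleCat.{u} R) : ov Z ⟶ Z := (exists_cover R Z).choose_spec.choose
instance (Z : ModuleCat.{u} R) : Epi (pr Z) := (exists_cover R Z).choose_spec.choose_spec.1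
instance ov_free (Z : ModuleCat.{u} R) : Module.Free R (ov Z) :=
  (exists_cover R Z).choose_spec.choose_spec.2.1
lemma ov_finite (Z : ModuleCat.{u} R) (h : Module.Finite R Z) : Module.Finite R (ov Z) :=
  (exists_cover R Z).choose_spec.choose_spec.2.2 h

lemma proj_of_free (M : ModuleCat.{u} R) (h : Module.Free R M) : Projective M :=
  (IsProjective.iff_projective (R := R) M).1 (Module.Projective.of_free)

noncomputable abbrev syz {X Y : ModuleCat.{u} R} (f : X ⟶ Y) : ModuleCat.{u} R := ov (kernel f)
noncomputable def dd {X Y : ModuleCat.{u} R} (f : X ⟶ Y) : syz f ⟶ X := pr (kernel f) ≫ kernel.ι f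

@[simp] lemma dd_comp {X Y : ModuleCat.{u} R} (f : X ⟶ Y) : dd f ≫ f = 0 := by simp [dd]

lemma dd_exact {X Y : ModuleCat.{u} R} (f : X ⟶ Y) :
    (ShortComplex.mk (dd f) f (dd_comp f)).Exact := by
  let α : ShortComplex.mk (dd f) f (dd_comp f) ⟶ ShortComplex.mk (kernel.ι f) f (by simp) :=
    { τ₁ := pr _
      τ₂ := 𝟙 _
      τ₃ := 𝟙 _
      comm₁₂ := by simp [dd]
      comm₂₃ := by simp }
  have : Epi α.τ₁ := by dsimp [α]; infer_instance
  have : IsIso α.τ₂ := by dsimp [α]; infer_instance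
  have : Mono α.τ₃ := by dsimp [α]; infer_instance
  rw [ShortComplex.exact_iff_of_epi_of_isIso_of_mono α]
  apply ShortComplex.exact_of_f_is_kernel
  apply kernelIsKernel

lemma syz_finite [IsNoetherianRing R] {X Y : ModuleCat.{u} R} (f : X ⟶ Y)
    (h : Module.Finite R X) : Module.Finite R (syz f) := by
  apply ov_finite
  exact Module.Finite.of_injective (kernel.ι f).hom ((ModuleCat.mono_iff_injective _).1 inferInstance)

variable (Z : ModuleCat.{u} R)

/-- A morphism together with its source and target. -/
structure Mor (R : Type u) [CommRing R] where
  X : ModuleCat.{u} R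
  Y : ModuleCat.{u} R
  f : X ⟶ Y

noncomputable def sq : ℕ → Mor R
  | 0 => ⟨ov Z, Z, pr Z⟩
  | n + 1 => ⟨syz (sq n).f, (sq n).X, dd (sq n).f⟩

noncomputable def cx : ChainComplex (ModuleCat.{u} R) ℕ :=
  ChainComplex.of (fun n => (sq Z n).X) (fun n => dd (sq Z n).f)
    (fun n => dd_comp (dd (sq Z n).f))

lemma cx_d (n : ℕ) : (cx Z).d (n + 1) n = dd (sq Z n).f :=
  ChainComplex.of_d (fun n => (sq Z n).X) (fun n => dd (sq Z n).f) n

lemma cx_exactAt_succ (n : ℕ) : (cx Z).ExactAt (n + 1) := by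
  rw [HomologicalComplex.exactAt_iff' _ (n + 1 + 1) (n + 1) n (by simp) (by simp)]
  have h := dd_exact (dd (sq Z n).f)
  rw [ShortComplex.ShortExact.moduleCat_exact_iff_function_exact] at h ⊢
  change Function.Exact ((cx Z).d (n + 1 + 1) (n + 1)) ((cx Z).d (n + 1) n)
  rw [cx_d, cx_d]
  exact h

lemma cx_free (n : ℕ) : Module.Free R ((cx Z).X n) := by
  cases n <;> exact ov_free _

lemma cx_finite [IsNoetherianRing R] (h : Module.Finite R Z) (n : ℕ) :
    Module.Finite R ((cx Z).X n) := by
  induction n with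
  | zero => exact ov_finite Z h
  | succ n ih => exact syz_finite (sq Z n).f ih

noncomputable def res : ProjectiveResolution Z where
  complex := cx Z
  projective n := proj_of_free _ (cx_free Z n)
  π := (ChainComplex.toSingle₀Equiv _ _).symm ⟨pr Z, by
          rw [cx_d]; exact dd_comp (pr Z)⟩
  quasiIso := ⟨fun n => by
    cases n
    · rw [ChainComplex.quasiIsoAt₀_iff, ShortComplex.quasiIso_iff_of_zeros']
      · refine (ShortComplex.exact_and_epi_g_iff_of_iso ?_).2
          ⟨dd_exact (pr Z), by dsimp; infer_instance⟩
        exact ShortComplex.isoMk (Iso.refl _) (Iso.refl _) (Iso.refl _)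
          (by
            change 𝟙 _ ≫ dd (pr Z) = (cx Z).d 1 0 ≫ 𝟙 _
            rw [cx_d, Category.id_comp]
            exact (Category.comp_id _).symm) (by
            refine (Category.id_comp (pr Z)).trans (Eq.trans ?_ (Category.comp_id _).symm)
            exact (ChainComplex.toSingle₀Equiv_symm_apply_f_zero (C := cx Z) (X := Z) (pr Z) _).symm)
      all_goals rfl
    · rw [quasiIsoAt_iff_exactAt']
      · apply cx_exactAt_succ
      · apply ChainComplex.exactAt_succ_single_obj⟩

end Res

section BC
variable (R R' : Type u) [CommRing R] [CommRing R'] [Algebra R R']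

noncomputable def bc : ModuleCat.{u} R ⥤ ModuleCat.{u} R' where
  obj M := ModuleCat.of R' (R' ⊗[R] M)
  map f := ModuleCat.ofHom (f.hom.baseChange R')
  map_id M := by ext x; simp
  map_comp f g := by ext x; simp [LinearMap.baseChange_comp]

instance : (bc R R').Additive where
  map_add {X Y f g} := by simp [bc, LinearMap.baseChange_add]; rfl

instance : (bc R R').PreservesProjectiveObjects where
  projective_obj {M} h := by
    have : Module.Projective R M := (IsProjective.iff_projective (R := R) M).2 h
    exact (IsProjective.iff_projective (R := R') (R' ⊗[R] M)).1 inferInstance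

lemma bc_exact [Module.Flat R R'] (S : ShortComplex (ModuleCat.{u} R)) (h : S.Exact) :
    (S.map (bc R R')).Exact := by
  rw [ShortComplex.ShortExact.moduleCat_exact_iff_function_exact] at h ⊢
  exact Module.Flat.lTensor_exact R' h

instance [Module.Flat R R'] : (bc R R').PreservesHomology := by
  have := ((Functor.exact_tfae (bc R R')).out 1 2).mp (bc_exact R R')
  exact this

variable {R R'}
noncomputable def homEquiv (M N : ModuleCat.{u} R) (N' : ModuleCat.{u} R')
    (e : R' ⊗[R] N ≃ₗ[R'] N')
    [Module.Free R M] [Module.Finite R M] :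
    (R' ⊗[R] (M ⟶ N)) ≃ₗ[R'] ((bc R R').obj M ⟶ N') :=
  (LinearEquiv.baseChange R R' _ _ ModuleCat.homLinearEquiv) ≪≫ₗ
  (IsBaseChange.linearMapLeftRight (TensorProduct.isBaseChange R M R')
    (TensorProduct.isBaseChange R N R')).equiv ≪≫ₗ
  LinearEquiv.congrRight e ≪≫ₗ
  (ModuleCat.homLinearEquiv (S := R') (M := (bc R R').obj M) (N := N')).symm

lemma homEquiv_tmul (M N : ModuleCat.{u} R) (N' : ModuleCat.{u} R')
    (e : R' ⊗[R] N ≃ₗ[R'] N')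
    [Module.Free R M] [Module.Finite R M] (s : R') (f : M ⟶ N) (t : R') (m : M) :
    (homEquiv M N N' e (s ⊗ₜ f)).hom (t ⊗ₜ[R] m : R' ⊗[R] M) = s • e (t ⊗ₜ f.hom m) := by
  change e ((IsBaseChange.linearMapLeftRight (TensorProduct.isBaseChange R M R')
    (TensorProduct.isBaseChange R N R')).equiv (s ⊗ₜ[R] f.hom) (t ⊗ₜ[R] m)) = _
  have : (t ⊗ₜ[R] m : R' ⊗[R] M) = t • TensorProduct.mk R R' M 1 m := by
    simp [TensorProduct.smul_tmul']
  rw [IsBaseChange.equiv_tmul, this, LinearMap.smul_apply, map_smul, map_smul,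
    IsBaseChange.linearMapLeftRightHom_comp_apply, map_smul, ← map_smul]
  simp [TensorProduct.smul_tmul']

lemma tens_ext {X : Type u} [AddCommGroup X] [Module R X] {Q : Type u} [AddCommGroup Q]
    [Module R' Q] (φ ψ : R' ⊗[R] X →ₗ[R'] Q) (h : ∀ s x, φ (s ⊗ₜ x) = ψ (s ⊗ₜ x)) : φ = ψ := by
  refine LinearMap.ext fun x => ?_
  induction x using TensorProduct.induction_on with
  | zero => simp
  | add x y hx hy => simp only [map_add, hx, hy]
  | tmul s f => exact h s f

noncomputable def cxIso (P : ChainComplex (ModuleCat.{u} R) ℕ) (N : ModuleCat.{u} R)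
    (N' : ModuleCat.{u} R') (e : R' ⊗[R] N ≃ₗ[R'] N')
    (h1 : ∀ n, Module.Free R (P.X n)) (h2 : ∀ n, Module.Finite R (P.X n)) :
    ((bc R R').mapHomologicalComplex _).obj (P.linearYonedaObj R N) ≅
    ChainComplex.linearYonedaObj (((bc R R').mapHomologicalComplex _).obj P) R' N' :=
  HomologicalComplex.Hom.isoOfComponents
    (fun i => (homEquiv (P.X i) N N' e).toModuleIso) (by
      intro i j hij
      refine ModuleCat.hom_ext (tens_ext _ _ fun s f => ?_)
      refine ModuleCat.hom_ext (tens_ext _ _ fun t m => ?_)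
      refine Eq.trans ?_ (homEquiv_tmul (P.X j) N N' e s (P.d j i ≫ f) t m).symm
      exact homEquiv_tmul (P.X i) N N' e s f t (P.d j i m))

theorem main [IsNoetherianRing R] [Module.Flat R R'] (M N : ModuleCat.{u} R)
    (M' N' : ModuleCat.{u} R') (hM : Module.Finite R M)
    (e : R' ⊗[R] N ≃ₗ[R'] N') (e' : R' ⊗[R] M ≃ₗ[R'] M') (n : ℕ) :
    Nonempty ((R' ⊗[R] (((Ext R (ModuleCat.{u} R) n).obj (op M)).obj N)) ≃ₗ[R']
      (((Ext R' (ModuleCat.{u} R') n).obj (op M')).obj N')) := by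
  let P := res M
  let C := P.complex.linearYonedaObj R N
  let i1 := (bc R R').mapIso (P.isoExt (R := R) n N)
  let i2 : (bc R R').obj (C.homology n) ≅ 
    (((bc R R').mapHomologicalComplex _).obj C).homology n :=
      ((C.sc n).mapHomologyIso (bc R R')).symm
  let i3 := HomologicalComplex.homologyMapIso
    (cxIso (R' := R') P.complex N N' e (cx_free M) (cx_finite M hM)) n
  let i4 := (((bc R R').mapProjectiveResolution P).isoExt (R := R') n N').symm
  let i5 : (((Ext R' (ModuleCat.{u} R') n).obj (op ((bc R R').obj M))).obj N') ≅
    (((Ext R' (ModuleCat.{u} R') n).obj (op M')).obj N') :=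
    ((Ext R' (ModuleCat.{u} R') n).mapIso
      (LinearEquiv.toModuleIso (X₁ := (bc R R').obj M) e').symm.op).app N'
  exact ⟨(i1 ≪≫ i2 ≪≫ i3 ≪≫ i4 ≪≫ i5).toLinearEquiv⟩
end BC
end ExtBC

theorem ext_residue_base_change
    (R R' : Type u) [CommRing R] [CommRing R'] [IsLocalRing R] [IsLocalRing R']
    [IsNoetherianRing R] [IsNoetherianRing R'] [Algebra R R']
    [IsLocalHom (algebraMap R R')] [Module.Flat R R']
    (hres : Function.Bijective (residueFieldBaseChange R R')) (n : ℕ) :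
    Nonempty
      ((R' ⊗[R] (((Ext R (ModuleCat.{u} R) n).obj
            (op (ModuleCat.of R (ResidueField R)))).obj
              (ModuleCat.of R (ResidueField R)))) ≃ₗ[R']
        (((Ext R' (ModuleCat.{u} R') n).obj
            (op (ModuleCat.of R' (ResidueField R')))).obj
              (ModuleCat.of R' (ResidueField R')))) := by
  let e : R' ⊗[R] ResidueField R ≃ₗ[R'] ResidueField R' :=
    LinearEquiv.ofBijective (residueFieldBaseChange R R').toLinearMap hres
  exact ExtBC.main _ _ _ _ (inferInstanceAs (Module.Finite R (ResidueField R))) e e n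
end

section
/- Let (R, 𝔪, k) be a commutative Noetherian local ring with 𝔪² = 0 and 𝔪 ≠ 0, and let e = dim_k 𝔪. Then dim_k Hom_R(k, R) = e, and for every n ≥ 1 one has dim_k Ext_R^n(k, R) = e^{n+1} − e^{n−1}. -/
universe u

open CategoryTheory Opposite IsLocalRing

namespace SqZero

section
variable {R : Type u} [CommRing R] [IsLocalRing R]

lemma length_residue : Module.length R (ResidueField R) = 1 := by
  rw [Module.length_eq_of_surjective (R := ResidueField R) (M := ResidueField R) (S := R)
    IsLocalRing.residue_surjective]
  exact Module.length_eq_one _ _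

lemma length_max {e : ℕ} (φ : maximalIdeal R ≃ₗ[R] (Fin e → ResidueField R)) :
    Module.length R (maximalIdeal R) = e := by
  rw [φ.length_eq, Module.length_pi, length_residue]; simp

lemma length_ring {e : ℕ} (φ : maximalIdeal R ≃ₗ[R] (Fin e → ResidueField R)) :
    Module.length R R = e + 1 := by
  have h : Module.length R (R ⧸ maximalIdeal R) = 1 := length_residue
  rw [Module.length_eq_add_of_exact (maximalIdeal R).subtype (maximalIdeal R).mkQ
    (Submodule.subtype_injective _) (Submodule.mkQ_surjective _)
    (LinearMap.exact_subtype_mkQ _), length_max φ, h]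

/-- a module killed by the maximal ideal, of length `n`, is `k^n`. -/
lemma equiv_of_length {M : Type u} [AddCommGroup M] [Module R M]
    (hM : ∀ x ∈ maximalIdeal R, ∀ y : M, x • y = 0) (n : ℕ) (hn : Module.length R M = n) :
    Nonempty (M ≃ₗ[R] (Fin n → ResidueField R)) := by
  have ht : Module.IsTorsionBySet R M (maximalIdeal R : Set R) := fun y x => hM x.1 x.2 y
  let : Module (ResidueField R) M := ht.module
  have : IsScalarTower R (ResidueField R) M := ht.isScalarTower
  have hfl : IsFiniteLength R M := by
    rw [← Module.length_ne_top_iff, hn]; exact ENat.natCast_ne_top n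
  have := (isFiniteLength_iff_isNoetherian_isArtinian.mp hfl).1
  have : Module.Finite R M := inferInstance
  have : Module.Finite (ResidueField R) M := Module.Finite.of_restrictScalars_finite R _ _
  have h2 : Module.finrank (ResidueField R) M = n := by
    have := Module.length_eq_of_surjective (R := ResidueField R) (M := M) (S := R)
      IsLocalRing.residue_surjective
    rw [hn, Module.length_eq_finrank] at this
    exact_mod_cast this.symm
  have h3 : Module.finrank (ResidueField R) (Fin n → ResidueField R) = n := by simp
  let E : M ≃ₗ[ResidueField R] (Fin n → ResidueField R) :=
    LinearEquiv.ofFinrankEq _ _ (h2.trans h3.symm)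
  exact ⟨E.restrictScalars R⟩

lemma mul_zero_of_mem (hm2 : (maximalIdeal R) ^ 2 = ⊥) {x y : R} (hx : x ∈ maximalIdeal R)
    (hy : y ∈ maximalIdeal R) : x * y = 0 := by
  have := Ideal.mul_mem_mul hx hy
  rwa [← pow_two, hm2] at this

lemma mem_of_mul_zero {x y : R} (hx : x ≠ 0) (h : x * y = 0) : y ∈ maximalIdeal R := by
  rw [mem_maximalIdeal, mem_nonunits_iff]
  intro hu
  exact hx (hu.mul_left_eq_zero.mp h)

lemma hom_part (hm2 : (maximalIdeal R) ^ 2 = ⊥) (hm0 : maximalIdeal R ≠ ⊥)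
    (e : ℕ) (φ : (maximalIdeal R) ≃ₗ[R] (Fin e → ResidueField R)) :
    Nonempty ((ResidueField R →ₗ[R] R) ≃ₗ[R] (Fin e → ResidueField R)) := by
  obtain ⟨y, hy, hy0⟩ := Submodule.exists_mem_ne_zero_of_ne_bot hm0
  let ev : (ResidueField R →ₗ[R] R) →ₗ[R] R := LinearMap.applyₗ (1 : ResidueField R)
  have hinj : Function.Injective ev := by
    intro f g hfg
    ext z
    obtain ⟨r, rfl⟩ := IsLocalRing.residue_surjective z
    have hr : IsLocalRing.residue R r = r • (1 : ResidueField R) := by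
      rw [Algebra.smul_def, mul_one]; rfl
    rw [hr, map_smul, map_smul]
    exact congrArg (r • ·) hfg
  have hrange : LinearMap.range ev = maximalIdeal R := by
    ext z
    constructor
    · rintro ⟨f, rfl⟩
      apply mem_of_mul_zero hy0
      change y • f 1 = 0
      rw [← map_smul, Algebra.smul_def, ResidueField.algebraMap_eq, (residue_eq_zero_iff y).2 hy]
      simp
    · intro hz
      refine ⟨Submodule.liftQ (maximalIdeal R) (LinearMap.toSpanSingleton R R z) ?_, ?_⟩
      · intro x hx
        simpa using mul_zero_of_mem hm2 hx hz
      · change (LinearMap.toSpanSingleton R R z) 1 = z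
        simp
  exact ⟨(LinearEquiv.ofInjective ev hinj).trans ((LinearEquiv.ofEq _ _ hrange).trans φ)⟩

/-- free modules in the resolution -/
abbrev F (R : Type u) (e n : ℕ) : Type u := (Fin n → Fin e) → R

variable {e : ℕ}

/-- the differential -/
def dd (x : Fin e → R) (n : ℕ) : F R e (n + 1) →ₗ[R] F R e n where
  toFun v t := ∑ i, x i * v (Fin.cons i t)
  map_add' v w := by ext t; simp [mul_add, Finset.sum_add_distrib]
  map_smul' r v := by ext t; simp [Finset.mul_sum, mul_left_comm]

lemma mem_range_dd (x : Fin e → R) (hx : ∀ i, x i ∈ maximalIdeal R)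
    (hspan : ∀ y ∈ maximalIdeal R, ∃ c : Fin e → R, ∑ i, x i * c i = y)
    (n : ℕ) (w : F R e n) :
    w ∈ LinearMap.range (dd x n) ↔ ∀ t, w t ∈ maximalIdeal R := by
  constructor
  · rintro ⟨v, rfl⟩ t
    change ∑ i, x i * v (Fin.cons i t) ∈ _
    exact Ideal.sum_mem _ fun i _ => Ideal.mul_mem_right _ _ (hx i)
  · intro h
    choose c hc using fun t => hspan (w t) (h t)
    refine ⟨fun s => c (Fin.tail s) (s 0), ?_⟩
    ext t
    simp [dd, hc]

lemma mem_ker_dd (hm2 : (maximalIdeal R) ^ 2 = ⊥) (x : Fin e → R)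
    (hx : ∀ i, x i ∈ maximalIdeal R)
    (hind : ∀ c : Fin e → R, ∑ i, x i * c i = 0 → ∀ i, c i ∈ maximalIdeal R)
    (n : ℕ) (v : F R e (n + 1)) :
    dd x n v = 0 ↔ ∀ t, v t ∈ maximalIdeal R := by
  constructor
  · intro h t
    have := hind _ (congrFun h (Fin.tail t)) (t 0)
    simpa using this
  · intro h
    ext t
    change ∑ i, x i * v (Fin.cons i t) = 0
    exact Finset.sum_eq_zero fun i _ => mul_zero_of_mem hm2 (hx i) (h _)

lemma exists_basis (φ : (maximalIdeal R) ≃ₗ[R] (Fin e → ResidueField R)) :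
    ∃ x : Fin e → R, (∀ i, x i ∈ maximalIdeal R) ∧
    (∀ y ∈ maximalIdeal R, ∃ c : Fin e → R, ∑ i, x i * c i = y) ∧
    (∀ c : Fin e → R, ∑ i, x i * c i = 0 → ∀ i, c i ∈ maximalIdeal R) := by
  let X : Fin e → maximalIdeal R := fun i => φ.symm (Pi.single i 1)
  have key : ∀ c : Fin e → R, φ (∑ i, c i • X i) = fun i => residue R (c i) := by
    intro c
    ext j
    simp only [map_sum, map_smul, X, LinearEquiv.apply_symm_apply, Finset.sum_apply, Pi.smul_apply]
    rw [Finset.sum_eq_single j]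
    · simp [Algebra.smul_def]
    · intro b _ hb
      simp [Pi.single_eq_of_ne hb.symm]
    · simp
  have coe : ∀ c : Fin e → R, ((∑ i, c i • X i : maximalIdeal R) : R) =
      ∑ i, (X i : R) * c i := by
    intro c
    simp [mul_comm]
  refine ⟨fun i => X i, fun i => (X i).2, ?_, ?_⟩
  · intro y hy
    choose c hc using fun i => IsLocalRing.residue_surjective (φ ⟨y, hy⟩ i)
    refine ⟨c, ?_⟩
    rw [← coe]
    have : (∑ i, c i • X i) = ⟨y, hy⟩ := φ.injective (by rw [key]; ext i; exact hc i)
    rw [this]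
  · intro c hc i
    rw [← coe] at hc
    have h0 : (∑ i, c i • X i) = 0 := Subtype.ext hc
    have := congrFun (key c) i
    rw [h0, map_zero] at this
    exact (residue_eq_zero_iff _).1 this.symm

end

section resolution

variable {R : Type u} [CommRing R] [IsLocalRing R] {e : ℕ}

/-- the complex of free modules -/
noncomputable def cx (x : Fin e → R) (h : ∀ n, dd x n ∘ₗ dd x (n + 1) = 0) :
    ChainComplex (ModuleCat.{u} R) ℕ :=
  ChainComplex.of (fun n => ModuleCat.of R (F R e n)) (fun n => ModuleCat.ofHom (dd x n))
    (fun n => by rw [← ModuleCat.ofHom_comp, h n]; rfl)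

set_option linter.unusedSectionVars false in
lemma cx_d (x : Fin e → R) (h : ∀ n, dd x n ∘ₗ dd x (n + 1) = 0) (n : ℕ) :
    (cx x h).d (n + 1) n = ModuleCat.ofHom (dd x n) :=
  ChainComplex.of_d (fun n => ModuleCat.of R (F R e n)) (fun n => ModuleCat.ofHom (dd x n)) n

/-- augmentation -/
noncomputable def aug (R : Type u) [CommRing R] [IsLocalRing R] (e : ℕ) : F R e 0 →ₗ[R] ResidueField R :=
  (Algebra.linearMap R (ResidueField R)) ∘ₗ LinearMap.proj (default : Fin 0 → Fin e)

lemma exists_resolution (hm2 : (maximalIdeal R) ^ 2 = ⊥) (x : Fin e → R)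
    (hx : ∀ i, x i ∈ maximalIdeal R)
    (hspan : ∀ y ∈ maximalIdeal R, ∃ c : Fin e → R, ∑ i, x i * c i = y)
    (hind : ∀ c : Fin e → R, ∑ i, x i * c i = 0 → ∀ i, c i ∈ maximalIdeal R)
    (h : ∀ n, dd x n ∘ₗ dd x (n + 1) = 0) :
    ∃ P : ProjectiveResolution (ModuleCat.of R (ResidueField R)), P.complex = cx x h := by
  have haug : ∀ v : F R e 0, aug R e v = 0 ↔ v ∈ LinearMap.range (dd x 0) := by
    intro v
    rw [mem_range_dd x hx hspan]
    change residue R (v default) = 0 ↔ _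
    rw [residue_eq_zero_iff, Unique.forall_iff]
  have hw : ModuleCat.ofHom (dd x 0) ≫ ModuleCat.ofHom (aug R e) = 0 := by
    ext v
    exact (haug _).2 ⟨_, rfl⟩
  have hex0 : (ShortComplex.mk _ _ hw).Exact := by
    rw [ShortComplex.moduleCat_exact_iff]
    intro v hv
    exact (haug v).1 hv
  have hepi : Epi (ModuleCat.ofHom (aug R e)) := by
    rw [ModuleCat.epi_iff_surjective]
    intro z
    obtain ⟨r, rfl⟩ := IsLocalRing.residue_surjective z
    exact ⟨fun _ => r, rfl⟩
  refine ⟨{ complex := cx x h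
            projective := ?_
            π := (ChainComplex.toSingle₀Equiv _ _).symm ⟨ModuleCat.ofHom (aug R e), ?_⟩
            quasiIso := ⟨fun n => ?_⟩ }, rfl⟩
  · intro n
    change Projective (ModuleCat.of R (F R e n))
    rw [← IsProjective.iff_projective]
    infer_instance
  · rw [cx_d]; exact hw
  · cases n with
    | zero =>
      rw [ChainComplex.quasiIsoAt₀_iff, ShortComplex.quasiIso_iff_of_zeros']
      · refine (ShortComplex.exact_and_epi_g_iff_of_iso ?_).2 ⟨hex0, hepi⟩
        exact ShortComplex.isoMk (Iso.refl _) (Iso.refl _) (Iso.refl _)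
          (by
            refine (Category.id_comp _).trans (Eq.trans ?_ (Category.comp_id _).symm)
            exact (cx_d x h 0).symm)
          (by
            refine (Category.id_comp _).trans (Eq.trans ?_ (Category.comp_id _).symm)
            exact (ChainComplex.toSingle₀Equiv_symm_apply_f_zero (C := cx x h)
              (X := ModuleCat.of R (ResidueField R)) (ModuleCat.ofHom (aug R e)) _).symm)
      all_goals rfl
    | succ n =>
      rw [quasiIsoAt_iff_exactAt']
      · rw [HomologicalComplex.exactAt_iff' _ (n + 1 + 1) (n + 1) n (by simp) (by simp)]
        rw [ShortComplex.moduleCat_exact_iff]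
        intro v hv
        change (cx x h).d (n+1) n v = 0 at hv
        change ∃ w, (cx x h).d (n+1+1) (n+1) w = v
        rw [cx_d] at hv ⊢
        have h1 := (mem_ker_dd hm2 x hx hind n v).1 hv
        exact (mem_range_dd x hx hspan (n+1) v).2 h1
      · apply ChainComplex.exactAt_succ_single_obj

lemma cohom_part (hm2 : (maximalIdeal R) ^ 2 = ⊥) (hm0 : maximalIdeal R ≠ ⊥)
    (φ : (maximalIdeal R) ≃ₗ[R] (Fin e → ResidueField R)) (x : Fin e → R)
    (hx : ∀ i, x i ∈ maximalIdeal R)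
    (hspan : ∀ y ∈ maximalIdeal R, ∃ c : Fin e → R, ∑ i, x i * c i = y)
    (h : ∀ n, dd x n ∘ₗ dd x (n + 1) = 0) (n : ℕ) :
    Nonempty (((cx x h).linearYonedaObj R (ModuleCat.of R R)).homology (n + 1) ≃ₗ[R]
      (Fin (e ^ (n + 2) - e ^ n) → ResidueField R)) := by
  obtain ⟨y, hy, hy0⟩ := Submodule.exists_mem_ne_zero_of_ne_bot hm0
  set K := (cx x h).linearYonedaObj R (ModuleCat.of R R) with hK
  -- the terms of `K`
  let E : ∀ n, ((Fin n → Fin e) → R) ≃ₗ[R] K.X n := fun n =>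
    ((Pi.basisFun R (Fin n → Fin e)).constr R).trans
      (ModuleCat.homLinearEquiv (S := R) (M := ModuleCat.of R (F R e n))
        (N := ModuleCat.of R R)).symm
  have hE : ∀ n w (v : F R e n), (show ModuleCat.of R (F R e n) ⟶ ModuleCat.of R R from E n w) v
      = ∑ t, v t * w t := by
    intro n w v
    change ((Pi.basisFun R (Fin n → Fin e)).constr R w) v = _
    simp [Module.Basis.constr_apply_fintype]
  have hd : ∀ n w, (K.d n (n + 1)).hom (E n w) = 0 ↔ ∀ t, w t ∈ maximalIdeal R := by
    intro n w
    have hd0 : (K.d n (n + 1)).hom (E n w) = ModuleCat.ofHom (dd x n) ≫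
        (show ModuleCat.of R (F R e n) ⟶ ModuleCat.of R R from E n w) := by
      rw [← cx_d x h]; rfl
    have hd1 : (K.d n (n + 1)).hom (E n w) = 0 ↔ ∀ v, ∑ t, dd x n v t * w t = 0 := by
      rw [hd0]
      constructor
      · intro h0 v
        rw [← hE]
        exact congrArg (fun f : ModuleCat.of R (F R e (n+1)) ⟶ ModuleCat.of R R => f v) h0
      · intro h0
        apply ModuleCat.hom_ext
        apply LinearMap.ext
        intro v
        exact (hE n w _).trans (h0 v)
    rw [hd1]
    constructor
    · intro h0 t
      apply mem_of_mul_zero hy0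
      obtain ⟨v, hv⟩ := (mem_range_dd x hx hspan n (Pi.single t y)).2 (by
        intro s
        by_cases hs : s = t
        · subst hs; simpa using hy
        · simp [hs])
      have := h0 v
      rw [hv] at this
      simpa [Pi.single_apply] using this
    · intro hw v
      refine Finset.sum_eq_zero fun t _ => mul_zero_of_mem hm2 ?_ (hw t)
      exact (mem_range_dd x hx hspan n _).1 ⟨v, rfl⟩ t
  have hcard : ∀ n, ENat.card (Fin n → Fin e) = (e ^ n : ℕ) := by
    intro n; simp
  have lenX : ∀ n, Module.length R (K.X n) = (e ^ n * (e + 1) : ℕ) := by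
    intro n
    rw [← (E n).length_eq, Module.length_pi, length_ring φ, hcard]; push_cast; rfl
  have lenZ : ∀ n, Module.length R (LinearMap.ker (K.d n (n + 1)).hom) = (e ^ n * e : ℕ) := by
    intro n
    let ψ : ((Fin n → Fin e) → maximalIdeal R) →ₗ[R] K.X n :=
      (E n).toLinearMap ∘ₗ (LinearMap.pi fun t => (maximalIdeal R).subtype ∘ₗ LinearMap.proj t)
    have hψ : Function.Injective ψ := by
      refine (E n).injective.comp ?_
      intro a b hab
      ext t
      exact congrFun hab t
    have hr : LinearMap.range ψ = LinearMap.ker (K.d n (n + 1)).hom := by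
      ext z
      obtain ⟨w, rfl⟩ := (E n).surjective z
      rw [LinearMap.mem_ker, hd]
      constructor
      · rintro ⟨a, ha⟩ t
        have := (E n).injective ha
        rw [← this]
        exact (a t).2
      · intro hw
        exact ⟨fun t => ⟨w t, hw t⟩, rfl⟩
    rw [← hr, ← (LinearEquiv.ofInjective ψ hψ).length_eq, Module.length_pi, length_max φ, hcard]
    push_cast; rfl
  have lenB : Module.length R (LinearMap.range (K.d n (n + 1)).hom) = (e ^ n : ℕ) := by
    have := Module.length_eq_add_of_exact (LinearMap.ker (K.d n (n + 1)).hom).subtype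
      (K.d n (n + 1)).hom.rangeRestrict (Submodule.subtype_injective _)
      (LinearMap.surjective_rangeRestrict _) (by
        rw [LinearMap.exact_iff, LinearMap.ker_rangeRestrict, Submodule.range_subtype])
    rw [lenX, lenZ, mul_add, mul_one, Nat.cast_add] at this
    exact (ENat.add_right_injective_of_ne_top (ENat.natCast_ne_top _) this).symm
  have hle : LinearMap.range (K.d n (n + 1)).hom ≤ LinearMap.ker (K.d (n + 1) (n + 1 + 1)).hom := by
    rintro _ ⟨z, rfl⟩
    rw [LinearMap.mem_ker, ← LinearMap.comp_apply, ← ModuleCat.hom_comp, K.d_comp_d]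
    rfl
  -- homology
  let S := K.sc' n (n + 1) (n + 1 + 1)
  let i1 : K.homology (n + 1) ≅ S.homology :=
    ShortComplex.homologyMapIso (K.isoSc' n (n + 1) (n + 1 + 1) (by simp) (by simp))
  let i2 := (i1 ≪≫ S.moduleCatHomologyIso).toLinearEquiv
  let Q := LinearMap.ker (K.d (n + 1) (n + 1 + 1)).hom ⧸
    ((LinearMap.range (K.d n (n + 1)).hom).submoduleOf _ )
  let i3 : K.homology (n + 1) ≃ₗ[R] Q := i2.trans (Submodule.quotEquivOfEq _ _ (by
    ext z
    constructor
    · rintro ⟨a, rfl⟩; exact ⟨a, rfl⟩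
    · rintro ⟨a, ha⟩; exact ⟨a, Subtype.ext ha⟩))
  have lenQ : Module.length R Q = (e ^ (n + 2) - e ^ n : ℕ) := by
    have := Module.length_eq_add_of_exact (Submodule.inclusion hle)
      ((LinearMap.range (K.d n (n + 1)).hom).submoduleOf
        (LinearMap.ker (K.d (n + 1) (n + 1 + 1)).hom)).mkQ (Submodule.inclusion_injective _)
      (Submodule.mkQ_surjective _) (by
        rw [LinearMap.exact_iff, Submodule.ker_mkQ, Submodule.range_inclusion]; rfl)
    rw [lenB, lenZ] at this
    have h2 : e ^ (n + 1) * e = e ^ n + (e ^ (n + 2) - e ^ n) := by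
      have he1 : 1 ≤ e := by
        rcases Nat.eq_zero_or_pos e with he | he
        · subst he
          obtain ⟨c, hc⟩ := hspan y hy
          simp at hc
          exact absurd hc.symm hy0
        · exact he
      have : e ^ n ≤ e ^ (n + 2) := Nat.pow_le_pow_right he1 (by omega)
      rw [← pow_succ]
      exact (Nat.add_sub_cancel' this).symm
    rw [h2, Nat.cast_add] at this
    exact (ENat.add_right_injective_of_ne_top (ENat.natCast_ne_top _) this).symm
  obtain ⟨i4⟩ := equiv_of_length (M := Q) (by
    intro r hr z
    obtain ⟨z, rfl⟩ := Submodule.Quotient.mk_surjective _ z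
    rw [← Submodule.Quotient.mk_smul]
    suffices r • z = 0 by rw [this]; rfl
    obtain ⟨z, hz⟩ := z
    obtain ⟨w, rfl⟩ := (E _).surjective z
    rw [LinearMap.mem_ker, hd] at hz
    apply Subtype.ext
    change r • E _ w = 0
    rw [← map_smul]
    have : r • w = 0 := by
      ext t
      exact mul_zero_of_mem hm2 hr (hz t)
    rw [this, map_zero]) _ lenQ
  exact ⟨i3.trans i4⟩

end resolution
end SqZero


theorem ext_into_ring_dimensions_of_sq_zero
    (R : Type u) [CommRing R] [IsLocalRing R] [IsNoetherianRing R]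
    (hm2 : (maximalIdeal R) ^ 2 = ⊥) (hm0 : maximalIdeal R ≠ ⊥)
    (e : ℕ) (he : Nonempty ((maximalIdeal R) ≃ₗ[R] (Fin e → ResidueField R))) :
    Nonempty ((ResidueField R →ₗ[R] R) ≃ₗ[R] (Fin e → ResidueField R)) ∧
    ∀ n : ℕ, 1 ≤ n →
      Nonempty
        ((((Ext R (ModuleCat.{u} R) n).obj (op (ModuleCat.of R (ResidueField R)))).obj
            (ModuleCat.of R R)) ≃ₗ[R]
          (Fin (e ^ (n + 1) - e ^ (n - 1)) → ResidueField R)) := by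
  obtain ⟨φ⟩ := he
  refine ⟨SqZero.hom_part hm2 hm0 e φ, fun n hn => ?_⟩
  obtain ⟨x, hx, hspan, hind⟩ := SqZero.exists_basis φ
  have h : ∀ n, SqZero.dd x n ∘ₗ SqZero.dd x (n + 1) = 0 := by
    intro n
    refine LinearMap.ext fun v => ?_
    exact (SqZero.mem_ker_dd hm2 x hx hind n _).2
      ((SqZero.mem_range_dd x hx hspan (n + 1) _).1 ⟨_, rfl⟩)
  obtain ⟨P, hP⟩ := SqZero.exists_resolution hm2 x hx hspan hind h
  obtain ⟨n, rfl⟩ : ∃ m, n = m + 1 := ⟨n - 1, by omega⟩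
  obtain ⟨i⟩ := SqZero.cohom_part hm2 hm0 φ x hx hspan h n
  rw [← hP] at i
  exact ⟨(P.isoExt (R := R) (n + 1) (ModuleCat.of R R)).toLinearEquiv.trans i⟩
end

section
/- Let k be a field and E = ⊕_{i ≥ 0} E^i a ℤ-graded (not necessarily commutative) k-algebra with E^0 = k and E^i = 0 for i < 0. For a graded left E-module M set ΓM = {μ ∈ M : there exists i ≥ 0 with E^j · μ = 0 for all j ≥ i}. Let S be a graded left E-module and ι : E → S an injective homomorphism of graded left E-modules (of degree 0) such that ι(E) ∩ ΓS = 0 and Γ(S/ι(E)) = S/ι(E). If S = ι(E) ⊕ T′ for some graded E-submodule T′ of S, then T′ = ΓS. -/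
/-- The "torsion" subset of a module `M` over a graded algebra `A` with grading `𝒜`:
elements annihilated by all components `𝒜 j` for all sufficiently large `j`. -/
def gammaTorsion {k A : Type*} [Field k] [Ring A] [Algebra k A]
    (𝒜 : ℤ → Submodule k A) (M : Type*) [AddCommGroup M] [Module A M] : Set M :=
  {μ | ∃ i : ℤ, 0 ≤ i ∧ ∀ j : ℤ, i ≤ j → ∀ a ∈ 𝒜 j, a • μ = 0}

/-- Let `k` be a field and `E = ⊕_{i ≥ 0} E^i` a graded `k`-algebra with
`E^0 = k` and `E^i = 0` for `i < 0` (here `E` is the algebra `A` with grading `𝒜`).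
Let `S` be a graded left `E`-module and `ι : E → S` an injective degree-zero homomorphism of
graded left `E`-modules such that `ι(E) ∩ ΓS = 0` and `Γ(S/ι(E)) = S/ι(E)`, where `Γ` is
the high-degree torsion functor.  If `S = ι(E) ⊕ T'` for a graded `E`-submodule `T'`,
then `T' = ΓS`. -/
theorem torsion_complement_eq_torsion
    {k A : Type*} [Field k] [Ring A] [Algebra k A]
    (𝒜 : ℤ → Submodule k A) [GradedAlgebra 𝒜]
    (h𝒜zero : 𝒜 0 = Subalgebra.toSubmodule (⊥ : Subalgebra k A))
    (h𝒜neg : ∀ i : ℤ, i < 0 → 𝒜 i = ⊥)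
    {S : Type*} [AddCommGroup S] [Module k S] [Module A S] [IsScalarTower k A S]
    (ℳ : ℤ → Submodule k S) [DirectSum.Decomposition ℳ] [SetLike.GradedSMul 𝒜 ℳ]
    (f : A →ₗ[A] S) (hfinj : Function.Injective f)
    (hfgraded : ∀ i : ℤ, ∀ a ∈ 𝒜 i, f a ∈ ℳ i)
    (hcap : ∀ s ∈ LinearMap.range f, s ∈ gammaTorsion 𝒜 S → s = 0)
    (hquot : ∀ x : S ⧸ LinearMap.range f, x ∈ gammaTorsion 𝒜 (S ⧸ LinearMap.range f))
    (T' : Submodule A S)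
    (hT'graded : ∀ (i : ℤ), ∀ s ∈ T', (DirectSum.decompose ℳ s i : S) ∈ T')
    (hcompl : IsCompl (LinearMap.range f) T') :
    (T' : Set S) = gammaTorsion 𝒜 S := by
  have hsub : ∀ t ∈ T', t ∈ gammaTorsion 𝒜 S := by
    intro t ht
    obtain ⟨i, hi, h⟩ := hquot (Submodule.Quotient.mk t)
    refine ⟨i, hi, fun j hj a ha => ?_⟩
    have h1 := h j hj a ha
    rw [← Submodule.Quotient.mk_smul, Submodule.Quotient.mk_eq_zero] at h1
    exact Submodule.disjoint_def.mp hcompl.disjoint _ h1 (T'.smul_mem a ht)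
  ext s
  refine ⟨fun hs => hsub s hs, fun hs => ?_⟩
  have hmem : s ∈ LinearMap.range f ⊔ T' := by
    rw [hcompl.sup_eq_top]
    exact Submodule.mem_top
  obtain ⟨y, hy, t, ht, rfl⟩ := Submodule.mem_sup.mp hmem
  have hy0 : y = 0 := by
    apply hcap y hy
    obtain ⟨i, hi, h⟩ := hs
    obtain ⟨i', _, h'⟩ := hsub t ht
    refine ⟨max i i', le_max_of_le_left hi, fun j hj a ha => ?_⟩
    have h1 := h j ((le_max_left _ _).trans hj) a ha
    rwa [smul_add, h' j ((le_max_right _ _).trans hj) a ha, add_zero] at h1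
  rw [hy0, zero_add]
  exact ht
end
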